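/- arXiv:2007.06399 — 2 statements merged into one kernel-verified Lean document; each statement's English description precedes it below -/
import Mathlib

section
/- Let T be a tree of diameter 5 with vertex set {v_1, ..., v_n}, where v_1 and v_2 are its two central vertices (the two adjacent vertices of eccentricity 3). For k = 1, 2, let NL_k be the set of neighbours of v_k other than v_{3-k} that are not leaves of T, and let m_k = min{ s_v : v ∈ NL_k }. Let s_1, ..., s_n be integers with s_i ≥ 2 for all i. If m_1 ≥ 4 and m_2 ≥ 4, then d̄(T(s_1, ..., s_n)) = 5; that is, T(s_1, ..., s_n) belongs to class C_0. -/
open SimpleGraph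

variable {V : Type*}

/-- `D` is an orientation of `G`: every arc of `D` is an edge of `G`, and every edge of `G`
receives exactly one of the two possible directions. -/
def IsOrientation (G : SimpleGraph V) (D : V → V → Prop) : Prop :=
  (∀ u v, D u v → G.Adj u v) ∧ ∀ u v, G.Adj u v → (D u v ↔ ¬ D v u)

/-- There is a directed walk of length `n` from `u` to `v` in the digraph `D`. -/
def DPath (D : V → V → Prop) : ℕ → V → V → Prop
  | 0, u, v => u = v
  | n + 1, u, v => ∃ w, D u w ∧ DPath D n w v

/-- Directed distance from `u` to `v` (`⊤` if `v` is not reachable from `u`). -/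
noncomputable def ddist (D : V → V → Prop) (u v : V) : ℕ∞ :=
  sInf {n : ℕ∞ | ∃ m : ℕ, n = (m : ℕ∞) ∧ DPath D m u v}

/-- Diameter of a digraph: supremum of directed distances over all ordered pairs. -/
noncomputable def odiam (D : V → V → Prop) : ℕ∞ :=
  ⨆ u : V, ⨆ v : V, ddist D u v

/-- A strong orientation of `G`: an orientation in which every vertex is reachable
from every other vertex by a directed path. -/
def IsStrongOrientation (G : SimpleGraph V) (D : V → V → Prop) : Prop :=
  IsOrientation G D ∧ ∀ u v, ∃ m : ℕ, DPath D m u v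

/-- The orientation number of `G`: minimum diameter over all strong orientations. -/
noncomputable def orientNum (G : SimpleGraph V) : ℕ∞ :=
  sInf {d : ℕ∞ | ∃ D : V → V → Prop, IsStrongOrientation G D ∧ d = odiam D}

/-- The vertex-multiplication `G(s)`: vertex `v` is replaced by `s v` copies, and copies of
`v_i`, `v_j` are adjacent iff `v_i v_j` is an edge of `G` (whence `i ≠ j`). -/
def vertexMult (G : SimpleGraph V) (s : V → ℕ) : SimpleGraph (Σ v : V, Fin (s v)) where
  Adj x y := G.Adj x.1 y.1
  symm := ⟨fun _ _ h => G.symm.symm _ _ h⟩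
  loopless := ⟨fun x h => G.loopless.irrefl x.1 h⟩

/-- Eccentricity of a vertex. -/
noncomputable def ecc (G : SimpleGraph V) (v : V) : ℕ∞ :=
  ⨆ u : V, G.edist v u

/-- `v` can be reached from `u` in the digraph `D` by a directed walk of length at most `n`. -/
def ReachWithin (D : V → V → Prop) (n : ℕ) (u v : V) : Prop :=
  ∃ m ≤ n, DPath D m u v

theorem DPath.append {D : V → V → Prop} {m n : ℕ} {u v w : V} (h : DPath D m u v)
    (h' : DPath D n v w) : DPath D (m + n) u w := by
  induction m generalizing u with
  | zero =>
    cases h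
    simpa using h'
  | succ m ih =>
    obtain ⟨x, hx, hxv⟩ := h
    rw [Nat.succ_add]
    exact ⟨x, hx, ih hxv⟩

namespace ReachWithin

variable {D : V → V → Prop} {m n : ℕ} {u v w : V}

theorem refl (D : V → V → Prop) (u : V) : ReachWithin D 0 u u :=
  ⟨0, le_rfl, rfl⟩

theorem of_arc (h : D u v) : ReachWithin D 1 u v :=
  ⟨1, le_rfl, v, h, rfl⟩

theorem trans (h : ReachWithin D m u v) (h' : ReachWithin D n v w) :
    ReachWithin D (m + n) u w := by
  obtain ⟨a, ha, hp⟩ := h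
  obtain ⟨b, hb, hq⟩ := h'
  exact ⟨a + b, by omega, hp.append hq⟩

theorem mono (h : ReachWithin D m u v) (hmn : m ≤ n) : ReachWithin D n u v := by
  obtain ⟨a, ha, hp⟩ := h
  exact ⟨a, by omega, hp⟩

theorem ddist_le (h : ReachWithin D n u v) : ddist D u v ≤ n := by
  obtain ⟨a, ha, hp⟩ := h
  exact le_trans (b := (a : ℕ∞)) (sInf_le ⟨a, rfl, hp⟩) (by exact_mod_cast ha)

end ReachWithin

theorem edist_le_of_dpath {G : SimpleGraph V} {s : V → ℕ}
    {D : (Σ v : V, Fin (s v)) → (Σ v : V, Fin (s v)) → Prop}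
    (hD : ∀ x y, D x y → (vertexMult G s).Adj x y) {m : ℕ} {x y : Σ v : V, Fin (s v)}
    (h : DPath D m x y) : G.edist x.1 y.1 ≤ m := by
  induction m generalizing x with
  | zero =>
    cases h
    simp
  | succ m ih =>
    obtain ⟨z, hxz, hzy⟩ := h
    have hadj : G.Adj x.1 z.1 := hD _ _ hxz
    calc G.edist x.1 y.1 ≤ G.edist x.1 z.1 + G.edist z.1 y.1 := G.edist_triangle
      _ ≤ 1 + m := add_le_add (edist_eq_one_iff_adj.2 hadj).le (ih hzy)
      _ = ((m + 1 : ℕ) : ℕ∞) := by push_cast; exact add_comm _ _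

theorem ediam_le_orientNum {G : SimpleGraph V} {s : V → ℕ} (hs : ∀ v, 0 < s v) :
    G.ediam ≤ orientNum (vertexMult G s) := by
  refine le_sInf ?_
  rintro d ⟨D, hD, rfl⟩
  refine ediam_le_of_edist_le fun u v => ?_
  refine le_trans ?_ (le_iSup₂ (f := ddist D) ⟨u, 0, hs u⟩ ⟨v, 0, hs v⟩)
  refine le_sInf ?_
  rintro _ ⟨m, rfl, hp⟩
  exact edist_le_of_dpath hD.1.1 hp

theorem orientNum_le_of_reachWithin {G : SimpleGraph V} {D : V → V → Prop} {n : ℕ}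
    (hD : IsOrientation G D) (h : ∀ u v, ReachWithin D n u v) : orientNum G ≤ n := by
  refine le_trans (b := odiam D) (sInf_le ⟨D, ⟨hD, fun u v => ?_⟩, rfl⟩)
    (iSup₂_le fun u v => (h u v).ddist_le)
  obtain ⟨m, -, hp⟩ := h u v
  exact ⟨m, hp⟩

section Core

variable {s : V → ℕ} {D : (Σ v : V, Fin (s v)) → (Σ v : V, Fin (s v)) → Prop} {a b : V} {ε : ℕ}

/-- Copies of `a` and `b` are joined according to the parity of the sum of their indices,
shifted by `ε`. -/
def CoreArcs (D : (Σ v : V, Fin (s v)) → (Σ v : V, Fin (s v)) → Prop) (a b : V) (ε : ℕ) : Prop :=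
  ∀ (i : Fin (s a)) (j : Fin (s b)),
    ((i.val + j.val + ε) % 2 = 0 → D ⟨a, i⟩ ⟨b, j⟩) ∧
    ((i.val + j.val + ε) % 2 = 1 → D ⟨b, j⟩ ⟨a, i⟩)

theorem exists_fin_mod_two {n : ℕ} (hn : 2 ≤ n) (t : ℕ) : ∃ i : Fin n, i.val % 2 = t % 2 :=
  ⟨⟨t % 2, by omega⟩, by simp⟩

namespace CoreArcs

theorem symm (H : CoreArcs D a b ε) : CoreArcs D b a (ε + 1) := fun i j =>
  ⟨fun h => (H j i).2 (by omega), fun h => (H j i).1 (by omega)⟩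

theorem exists_out (H : CoreArcs D a b ε) (hb : 2 ≤ s b) (i : Fin (s a)) :
    ∃ j, D ⟨a, i⟩ ⟨b, j⟩ := by
  obtain ⟨j, hj⟩ := exists_fin_mod_two hb (i.val + ε)
  exact ⟨j, (H i j).1 (by omega)⟩

theorem exists_in (H : CoreArcs D a b ε) (ha : 2 ≤ s a) (j : Fin (s b)) :
    ∃ i, D ⟨a, i⟩ ⟨b, j⟩ := by
  obtain ⟨i, hi⟩ := exists_fin_mod_two ha (j.val + ε)
  exact ⟨i, (H i j).1 (by omega)⟩

theorem reach_two (H : CoreArcs D a b ε) (hb : 2 ≤ s b) {i j : Fin (s a)}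
    (hij : i.val % 2 ≠ j.val % 2) : ReachWithin D 2 ⟨a, i⟩ ⟨a, j⟩ := by
  obtain ⟨k, hk⟩ := exists_fin_mod_two hb (i.val + ε)
  exact (ReachWithin.of_arc ((H i k).1 (by omega))).trans
    (ReachWithin.of_arc ((H j k).2 (by omega)))

theorem reach_same (H : CoreArcs D a b ε) (ha : 2 ≤ s a) (hb : 2 ≤ s b) (i j : Fin (s a)) :
    ReachWithin D 4 ⟨a, i⟩ ⟨a, j⟩ := by
  by_cases hij : i.val % 2 = j.val % 2
  · obtain ⟨k, hk⟩ := exists_fin_mod_two ha (i.val + 1)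
    exact (H.reach_two hb (by omega : i.val % 2 ≠ k.val % 2)).trans
      (H.reach_two hb (by omega : k.val % 2 ≠ j.val % 2))
  · exact (H.reach_two hb hij).mono (by omega)

theorem reach_cross (H : CoreArcs D a b ε) (ha : 2 ≤ s a) (hb : 2 ≤ s b)
    (i : Fin (s a)) (j : Fin (s b)) : ReachWithin D 3 ⟨a, i⟩ ⟨b, j⟩ := by
  obtain ⟨k, hk⟩ := exists_fin_mod_two hb (i.val + ε)
  have hik := ReachWithin.of_arc ((H i k).1 (by omega))
  by_cases hkj : k.val % 2 = j.val % 2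
  · exact (ReachWithin.of_arc ((H i j).1 (by omega))).mono (by omega)
  · exact hik.trans (H.symm.reach_two ha hkj)

end CoreArcs

/-- `x` is a copy of `c`, or is joined to the copies of `c` according to index parity, or is
within distance two of all copies of `c` in both directions. -/
def Attached (D : (Σ v : V, Fin (s v)) → (Σ v : V, Fin (s v)) → Prop) (c : V)
    (x : Σ v : V, Fin (s v)) : Prop :=
  (∃ i, x = ⟨c, i⟩) ∨
  (∃ r : ℕ, ∀ i : Fin (s c), (i.val % 2 = r % 2 → ReachWithin D 1 x ⟨c, i⟩) ∧
    (i.val % 2 ≠ r % 2 → ReachWithin D 1 ⟨c, i⟩ x)) ∨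
  ∀ i : Fin (s c), ReachWithin D 2 x ⟨c, i⟩ ∧ ReachWithin D 2 ⟨c, i⟩ x

/-- Any two vertices attached to the same side are within distance five. -/
theorem Attached.reach_same (H : CoreArcs D a b ε) (ha : 2 ≤ s a) (hb : 2 ≤ s b)
    {x y : Σ v : V, Fin (s v)} (hx : Attached D a x) (hy : Attached D a y) :
    ReachWithin D 5 x y := by
  obtain ⟨i₀, -⟩ := exists_fin_mod_two ha 0
  rcases hx with ⟨i, rfl⟩ | ⟨r, hr⟩ | hx
  · rcases hy with ⟨j, rfl⟩ | ⟨q, hq⟩ | hy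
    · exact (H.reach_same ha hb i j).mono (by omega)
    · obtain ⟨j, hj⟩ := exists_fin_mod_two ha (q + 1)
      exact (H.reach_same ha hb i j).trans ((hq j).2 (by omega))
    · exact (hy i).2.mono (by omega)
  · obtain ⟨i, hi⟩ := exists_fin_mod_two ha r
    have hxi := (hr i).1 hi
    rcases hy with ⟨j, rfl⟩ | ⟨q, hq⟩ | hy
    · exact hxi.trans (H.reach_same ha hb i j)
    · by_cases hqr : r % 2 = q % 2
      · obtain ⟨j, hj⟩ := exists_fin_mod_two ha (q + 1)
        exact ((hxi.trans (H.reach_two hb (by omega : i.val % 2 ≠ j.val % 2))).trans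
          ((hq j).2 (by omega))).mono (by omega)
      · exact (hxi.trans ((hq i).2 (by omega))).mono (by omega)
    · exact (hxi.trans (hy i).2).mono (by omega)
  · rcases hy with ⟨j, rfl⟩ | ⟨q, hq⟩ | hy
    · exact (hx j).1.mono (by omega)
    · obtain ⟨j, hj⟩ := exists_fin_mod_two ha (q + 1)
      exact ((hx j).1.trans ((hq j).2 (by omega))).mono (by omega)
    · exact ((hx i₀).1.trans (hy i₀).2).mono (by omega)

/-- Any two vertices attached to opposite sides are within distance five. -/
theorem Attached.reach_cross (H : CoreArcs D a b ε) (ha : 2 ≤ s a) (hb : 2 ≤ s b)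
    {x y : Σ v : V, Fin (s v)} (hx : Attached D a x) (hy : Attached D b y) :
    ReachWithin D 5 x y := by
  obtain ⟨i₀, -⟩ := exists_fin_mod_two ha 0
  have hout (i : Fin (s a)) : ∃ j : Fin (s b), ReachWithin D 1 ⟨a, i⟩ ⟨b, j⟩ :=
    (H.exists_out hb i).imp fun _ => ReachWithin.of_arc
  have hin (j : Fin (s b)) : ∃ i : Fin (s a), ReachWithin D 1 ⟨a, i⟩ ⟨b, j⟩ :=
    (H.exists_in ha j).imp fun _ => ReachWithin.of_arc
  rcases hx with ⟨i, rfl⟩ | ⟨r, hr⟩ | hx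
  · rcases hy with ⟨j, rfl⟩ | ⟨q, hq⟩ | hy
    · exact (H.reach_cross ha hb i j).mono (by omega)
    · obtain ⟨j, hj⟩ := exists_fin_mod_two hb (q + 1)
      exact ((H.reach_cross ha hb i j).trans ((hq j).2 (by omega))).mono (by omega)
    · obtain ⟨j, hj⟩ := hout i
      exact (hj.trans (hy j).2).mono (by omega)
  · obtain ⟨i, hi⟩ := exists_fin_mod_two ha r
    have hxi := (hr i).1 hi
    rcases hy with ⟨j, rfl⟩ | ⟨q, hq⟩ | hy
    · exact (hxi.trans (H.reach_cross ha hb i j)).mono (by omega)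
    · obtain ⟨j, hj⟩ := exists_fin_mod_two hb (q + 1)
      exact (hxi.trans (H.reach_cross ha hb i j)).trans ((hq j).2 (by omega))
    · obtain ⟨j, hj⟩ := hout i
      exact ((hxi.trans hj).trans (hy j).2).mono (by omega)
  · rcases hy with ⟨j, rfl⟩ | ⟨q, hq⟩ | hy
    · obtain ⟨i, hi⟩ := hin j
      exact ((hx i).1.trans hi).mono (by omega)
    · obtain ⟨j, hj⟩ := exists_fin_mod_two hb (q + 1)
      obtain ⟨i, hi⟩ := hin j
      exact (((hx i).1.trans hi).trans ((hq j).2 (by omega))).mono (by omega)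
    · obtain ⟨j, hj⟩ := hout i₀
      exact ((hx i₀).1.trans hj).trans (hy j).2

end Core

section LevelOrientation

variable {s : V → ℕ} {G : SimpleGraph V} {h f : V → ℕ}

/-- The rule deciding whether the `i`-th copy of a vertex points to the `j`-th copy of a later
vertex on level `l`. -/
def levelRule (l i j : ℕ) : Prop :=
  if l = 0 then i % 2 = j % 2 else if l = 1 then i % 2 ≠ j % 2 else i / 2 % 2 ≠ j % 2

/-- Vertices compared by level `h`, ties being broken by `f`. -/
def LevelLT (h f : V → ℕ) (x y : V) : Prop :=
  h x < h y ∨ h x = h y ∧ f x < f y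

/-- The orientation of `G(s)` given by `levelRule` along the order `LevelLT`. -/
def levelOrientation (G : SimpleGraph V) (s h f : V → ℕ) (x y : Σ v : V, Fin (s v)) : Prop :=
  G.Adj x.1 y.1 ∧
    (LevelLT h f x.1 y.1 ∧ levelRule (h y.1) x.2 y.2 ∨
      LevelLT h f y.1 x.1 ∧ ¬ levelRule (h x.1) y.2 x.2)

theorem isOrientation_levelOrientation (hf : ∀ x y, G.Adj x y → f x ≠ f y) :
    IsOrientation (vertexMult G s) (levelOrientation G s h f) := by
  refine ⟨fun x y hxy => hxy.1, fun x y hxy => ?_⟩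
  have hadj : G.Adj x.1 y.1 := hxy
  have hne := hf _ _ hadj
  have hadj' := hadj.symm
  by_cases hlt : LevelLT h f x.1 y.1
  · have hgt : ¬ LevelLT h f y.1 x.1 := by unfold LevelLT at *; omega
    simp only [levelOrientation]
    tauto
  · have hgt : LevelLT h f y.1 x.1 := by unfold LevelLT at *; omega
    simp only [levelOrientation]
    tauto

theorem attached_levelOrientation_zero {c : V} (i : Fin (s c)) :
    Attached (levelOrientation G s h f) c ⟨c, i⟩ :=
  Or.inl ⟨i, rfl⟩

theorem levelOrientation_child {c x : V} (hcx : G.Adj c x) (hc : h c = 0) (hx : h x = 1)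
    (r : Fin (s x)) (i : Fin (s c)) :
    (i.val % 2 = r.val % 2 → levelOrientation G s h f ⟨x, r⟩ ⟨c, i⟩) ∧
    (i.val % 2 ≠ r.val % 2 → levelOrientation G s h f ⟨c, i⟩ ⟨x, r⟩) := by
  have hlt : LevelLT h f c x := Or.inl (by omega)
  refine ⟨fun hi => ⟨hcx.symm, Or.inr ⟨hlt, ?_⟩⟩, fun hi => ⟨hcx, Or.inl ⟨hlt, ?_⟩⟩⟩ <;>
    simp [levelRule, hx, hi]

theorem attached_levelOrientation_one {c x : V} (hcx : G.Adj c x) (hc : h c = 0) (hx : h x = 1)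
    (r : Fin (s x)) : Attached (levelOrientation G s h f) c ⟨x, r⟩ :=
  Or.inr <| Or.inl ⟨r, fun i =>
    ⟨fun hi => .of_arc ((levelOrientation_child hcx hc hx r i).1 hi),
      fun hi => .of_arc ((levelOrientation_child hcx hc hx r i).2 hi)⟩⟩

theorem attached_levelOrientation_two {c u w : V} (hcu : G.Adj c u) (huw : G.Adj u w)
    (hc : h c = 0) (hu : h u = 1) (hw : h w = 2) (hsu : 4 ≤ s u) (j : Fin (s w)) :
    Attached (levelOrientation G s h f) c ⟨w, j⟩ := by
  refine Or.inr <| Or.inr fun i => ?_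
  have hlt : LevelLT h f u w := Or.inl (by omega)
  constructor
  · let k : Fin (s u) := ⟨2 * (j.val % 2) + i.val % 2, by omega⟩
    refine ReachWithin.trans (m := 1) (n := 1) (v := ⟨u, k⟩) (.of_arc ?_) (.of_arc ?_)
    · refine ⟨huw.symm, Or.inr ⟨hlt, ?_⟩⟩
      simp only [levelRule, hw, k]
      norm_num
      omega
    · exact (levelOrientation_child hcu hc hu k i).1 (by simp only [k]; omega)
  · let k : Fin (s u) := ⟨2 * (1 - j.val % 2) + (1 - i.val % 2), by omega⟩
    refine ReachWithin.trans (m := 1) (n := 1) (v := ⟨u, k⟩) (.of_arc ?_) (.of_arc ?_)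
    · exact (levelOrientation_child hcu hc hu k i).2 (by simp only [k]; omega)
    · refine ⟨huw, Or.inl ⟨hlt, ?_⟩⟩
      simp only [levelRule, hw, k]
      norm_num
      omega

theorem coreArcs_levelOrientation {a b : V} (hab : G.Adj a b) (ha : h a = 0) (hb : h b = 0)
    (hf : f a < f b) : CoreArcs (levelOrientation G s h f) a b 0 := by
  intro i j
  have hlt : LevelLT h f a b := Or.inr ⟨by omega, hf⟩
  refine ⟨fun hij => ⟨hab, Or.inl ⟨hlt, ?_⟩⟩, fun hij => ⟨hab.symm, Or.inr ⟨hlt, ?_⟩⟩⟩ <;>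
    simp only [levelRule, hb, if_true] <;> omega

end LevelOrientation

/-- A vertex-multiplication has orientation number at most five when every vertex is one of two
adjacent vertices `a`, `b`, or a neighbor of `a` or `b`, or a neighbor of such a neighbor of
multiplicity at least four. -/
theorem orientNum_vertexMult_le_five {G : SimpleGraph V} {s h f : V → ℕ} {a b : V}
    (hs : ∀ v, 2 ≤ s v) (hab : G.Adj a b) (ha : h a = 0) (hb : h b = 0)
    (hf : ∀ x y, G.Adj x y → f x ≠ f y) (hfab : f a < f b)
    (hlevel : ∀ x, (x = a ∨ x = b) ∨ ∃ c, (c = a ∨ c = b) ∧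
      (G.Adj c x ∧ h x = 1 ∨ h x = 2 ∧ ∃ u, h u = 1 ∧ G.Adj c u ∧ G.Adj u x ∧ 4 ≤ s u)) :
    orientNum (vertexMult G s) ≤ 5 := by
  have H := coreArcs_levelOrientation (s := s) hab ha hb hfab
  have key (x : Σ v : V, Fin (s v)) : Attached (levelOrientation G s h f) a x ∨
      Attached (levelOrientation G s h f) b x := by
    obtain ⟨x, i⟩ := x
    rcases hlevel x with (rfl | rfl) | ⟨c, hc, hx⟩
    · exact .inl (attached_levelOrientation_zero i)
    · exact .inr (attached_levelOrientation_zero i)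
    · have hc0 : h c = 0 := by rcases hc with rfl | rfl <;> assumption
      have hatt : Attached (levelOrientation G s h f) c ⟨x, i⟩ := by
        rcases hx with ⟨hcx, hx⟩ | ⟨hx, u, hu, hcu, hux, hsu⟩
        · exact attached_levelOrientation_one hcx hc0 hx i
        · exact attached_levelOrientation_two hcu hux hc0 hu hx hsu i
      rcases hc with rfl | rfl
      · exact .inl hatt
      · exact .inr hatt
  refine orientNum_le_of_reachWithin (n := 5) (isOrientation_levelOrientation (h := h) hf) fun x y => ?_
  rcases key x with hx | hx <;> rcases key y with hy | hy
  · exact hx.reach_same H (hs a) (hs b) hy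
  · exact hx.reach_cross H (hs a) (hs b) hy
  · exact hx.reach_cross H.symm (hs b) (hs a) hy
  · exact hx.reach_same H.symm (hs b) (hs a) hy

theorem dist_le_of_ecc_eq {G : SimpleGraph V} (hG : G.Connected) {v : V} {n : ℕ}
    (h : ecc G v = n) (x : V) : G.dist v x ≤ n := by
  have hle : G.edist v x ≤ n := h ▸ le_iSup (fun u => G.edist v u) x
  rw [← (hG v x).coe_dist_eq_edist] at hle
  exact_mod_cast hle

theorem ncard_neighborSet_ne_one {G : SimpleGraph V} {u x y : V} (hx : G.Adj u x)
    (hy : G.Adj u y) (hxy : x ≠ y) : (G.neighborSet u).ncard ≠ 1 := by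
  intro h
  obtain ⟨z, hz⟩ := Set.ncard_eq_one.1 h
  have hx' : x ∈ G.neighborSet u := hx
  have hy' : y ∈ G.neighborSet u := hy
  rw [hz, Set.mem_singleton_iff] at hx' hy'
  exact hxy (hx'.trans hy'.symm)

/-- A vertex at distance two is reached through an intermediate vertex at distance one. -/
theorem exists_adj_adj_of_dist_eq_two {G : SimpleGraph V} {c x : V} (h : G.dist c x = 2) :
    ∃ u, G.Adj c u ∧ G.Adj u x := by
  obtain ⟨p, hp⟩ := exists_walk_of_dist_ne_zero (by omega : G.dist c x ≠ 0)
  rw [h] at hp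
  match p, hp with
  | .cons hcu (.cons hux .nil), _ => exact ⟨_, hcu, hux⟩

/-- In a tree, a vertex within distance three of both ends of an edge is within distance two of
one of them. -/
theorem exists_level_of_isTree {T : SimpleGraph V} (hT : T.IsTree) {a b : V} (hab : T.Adj a b)
    {x : V} (ha : T.dist a x ≤ 3) (hb : T.dist b x ≤ 3) :
    (x = a ∨ x = b) ∨ ∃ c, (c = a ∨ c = b) ∧
      (T.Adj c x ∧ min (T.dist a x) (T.dist b x) = 1 ∨
        min (T.dist a x) (T.dist b x) = 2 ∧ T.dist c x = 2) := by
  have hne := hT.dist_ne_of_adj x hab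
  rw [dist_comm, dist_comm (u := x)] at hne
  rcases eq_or_ne x a with rfl | hxa
  · exact .inl (.inl rfl)
  rcases eq_or_ne x b with rfl | hxb
  · exact .inl (.inr rfl)
  have hpa := hT.connected.pos_dist_of_ne hxa.symm
  have hpb := hT.connected.pos_dist_of_ne hxb.symm
  right
  rcases lt_or_gt_of_ne hne with hlt | hlt
  · refine ⟨a, .inl rfl, ?_⟩
    rcases (by omega : T.dist a x = 1 ∨ T.dist a x = 2) with h1 | h2
    · exact .inl ⟨dist_eq_one_iff_adj.1 h1, by omega⟩
    · exact .inr ⟨by omega, h2⟩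
  · refine ⟨b, .inr rfl, ?_⟩
    rcases (by omega : T.dist b x = 1 ∨ T.dist b x = 2) with h1 | h2
    · exact .inl ⟨dist_eq_one_iff_adj.1 h1, by omega⟩
    · exact .inr ⟨by omega, h2⟩

theorem stmt12 [Fintype V] (T : SimpleGraph V) (hT : T.IsTree) (hdiam : T.ediam = 5)
    (v₁ v₂ : V) (hadj : T.Adj v₁ v₂) (hecc₁ : ecc T v₁ = 3) (hecc₂ : ecc T v₂ = 3)
    (s : V → ℕ) (hs : ∀ v, 2 ≤ s v)
    (NL₁ NL₂ : Set V)
    (hNL₁ : NL₁ = {u : V | T.Adj v₁ u ∧ u ≠ v₂ ∧ (T.neighborSet u).ncard ≠ 1})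
    (hNL₂ : NL₂ = {u : V | T.Adj v₂ u ∧ u ≠ v₁ ∧ (T.neighborSet u).ncard ≠ 1})
    (m₁ m₂ : ℕ) (hm₁ : m₁ = sInf (s '' NL₁)) (hm₂ : m₂ = sInf (s '' NL₂))
    (hm : 4 ≤ m₁ ∧ 4 ≤ m₂) :
    orientNum (vertexMult T s) = 5 := by
  subst hNL₁ hNL₂ hm₁ hm₂
  have hconn := hT.connected
  refine le_antisymm ?_ (hdiam ▸ ediam_le_orientNum fun v => by have := hs v; omega)
  refine orientNum_vertexMult_le_five (h := fun x => min (T.dist v₁ x) (T.dist v₂ x))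
    (f := T.dist v₁) hs hadj (by simp) (by simp) (fun x y hxy => hT.dist_ne_of_adj v₁ hxy)
    (by simpa using hconn.pos_dist_of_ne hadj.ne) fun x => ?_
  refine (exists_level_of_isTree hT hadj (dist_le_of_ecc_eq hconn (by simpa using hecc₁) x)
    (dist_le_of_ecc_eq hconn (by simpa using hecc₂) x)).imp_right ?_
  rintro ⟨c, hc, hx | ⟨hx, hcx⟩⟩
  · exact ⟨c, hc, .inl hx⟩
  obtain ⟨u, hcu, hux⟩ := exists_adj_adj_of_dist_eq_two hcx
  have hcx_ne : c ≠ x := by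
    rintro rfl
    simp at hcx
  have hcard := ncard_neighborSet_ne_one hcu.symm hux hcx_ne
  have hnot (d : V) (hd : T.dist d x ≠ 1) : u ≠ d := by
    rintro rfl
    exact hd (dist_eq_one_iff_adj.2 hux)
  have hu₁ := hnot v₁ (by omega)
  have hu₂ := hnot v₂ (by omega)
  have hp₁ := hconn.pos_dist_of_ne hu₁.symm
  have hp₂ := hconn.pos_dist_of_ne hu₂.symm
  have hcu' := dist_eq_one_iff_adj.2 hcu
  refine ⟨c, hc, .inr ⟨hx, u, ?_, hcu, hux, ?_⟩⟩
  · rcases hc with rfl | rfl <;> omega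
  · rcases hc with rfl | rfl
    · exact hm.1.trans (Nat.sInf_le ⟨u, ⟨hcu, hu₂, hcard⟩, rfl⟩)
    · exact hm.2.trans (Nat.sInf_le ⟨u, ⟨hcu, hu₁, hcard⟩, rfl⟩)
end

section
/- Let T be a tree of diameter 5 with vertex set {v_1, ..., v_n}, where v_1 and v_2 are its two central vertices (the two adjacent vertices of eccentricity 3). For k = 1, 2, let NL_k be the set of neighbours of v_k other than v_{3-k} that are not leaves of T, and let m_k = min{ s_v : v ∈ NL_k }. Let s_1, ..., s_n be integers with s_i ≥ 2 for all i. Then T(s_1, ..., s_n) ∈ C_0 (i.e., d̄(T(s_1, ..., s_n)) = 5) if and only if at least one of the following holds: (1) s_1 ≥ 3 or s_2 ≥ 3; (2) m_1 ≥ 4 and m_2 ≥ 4; (3) |NL_k| = 1 for some k ∈ {1, 2}. Otherwise, T(s_1, ..., s_n) ∈ C_1 (i.e., d̄(T(s_1, ..., s_n)) = 6). -/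
open SimpleGraph

variable {V : Type*}

/-- The part a vertex plays in a tree of diameter `5` with central vertices `a` and `b`: `p` and
`q` are the non-leaf neighbours of `a` and `b`, `z` and `w` their leaf neighbours, `x` and `y` the
leaves attached to a vertex of kind `p` or `q`. -/
inductive Role | a | b | p | q | x | y | z | w
  deriving DecidableEq

namespace Role

instance : Fintype Role where
  elems := {a, b, p, q, x, y, z, w}
  complete r := by cases r <;> decide

def down : Role → Role → Bool
  | a, b | a, p | a, z | p, x | b, q | b, w | q, y => true
  | _, _ => false

def adj (r t : Role) : Bool := down r t || down t r

def hub (r : Role) : Bool := r = a || r = b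

def inner (r : Role) : Bool := r ≠ z && r ≠ w

/-- Position on the path `x, p, a, b, q, y` onto which the roles fold. -/
def pos : Role → ℕ
  | x => 0 | p => 1 | z => 1 | a => 2 | b => 3 | q => 4 | w => 4 | y => 5

theorem pos_of_adj : ∀ {r t : Role}, adj r t → pos t = pos r + 1 ∨ pos r = pos t + 1 := by
  decide

theorem adj_comm (r t : Role) : adj r t = adj t r := Bool.or_comm _ _

theorem down_asymm : ∀ {r t : Role}, down r t → down t r = false := by decide

theorem eq_of_adj_chain_x_q : ∀ {r t u : Role}, adj x r → adj r t → adj t u → adj u q →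
    r = p ∧ t = a ∧ u = b := by
  intro r t u
  cases r <;> cases t <;> cases u <;> decide

theorem eq_of_adj_chain_p_y : ∀ {r t u : Role}, adj p r → adj r t → adj t u → adj u y →
    r = a := by
  decide +kernel

theorem eq_of_adj_chain_x_x : ∀ {r t u : Role}, adj x r → adj r t → adj t u → adj u x →
    r = p ∧ (t = a ∨ t = x) ∧ u = p := by
  decide +kernel

end Role

/-- `role` describes `T` as a tree of diameter `5` with central vertices `a` and `b`. -/
structure IsRoleMap (T : SimpleGraph V) (a b : V) (role : V → Role) : Prop where
  adj {v w : V} : T.Adj v w → (role v).adj (role w)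
  exists_adj (v : V) {r : Role} : r.inner → r.adj (role v) → ∃ w, role w = r ∧ T.Adj w v
  adj_of_hub {v w : V} : (role v).hub → (role v).adj (role w) → T.Adj v w
  leaf {v w w' : V} : role v = .x ∨ role v = .y → T.Adj v w → T.Adj v w' → w = w'
  eq_a {v : V} : role v = .a ↔ v = a
  eq_b {v : V} : role v = .b ↔ v = b
  eq_p {v : V} : role v = .p ↔ T.Adj a v ∧ v ≠ b ∧ (T.neighborSet v).ncard ≠ 1
  eq_q {v : V} : role v = .q ↔ T.Adj b v ∧ v ≠ a ∧ (T.neighborSet v).ncard ≠ 1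

theorem eq_of_adj_of_dist_lt {T : SimpleGraph V} (hT : T.IsTree) {r v w w' : V}
    (hw : T.Adj v w) (hw' : T.Adj v w') (h : T.dist r w < T.dist r v)
    (h' : T.dist r w' < T.dist r v) : w = w' := by
  classical
  obtain ⟨P, hP, -⟩ := hT.connected.exists_path_of_dist r v
  have key : ∀ c, T.Adj v c → T.dist r c < T.dist r v → c = P.penultimate := by
    intro c hc hlt
    obtain ⟨Q, hQ, hQl⟩ := hT.connected.exists_path_of_dist r c
    refine hT.isAcyclic.eq_penultimate_of_adj_end hP hc
      (hT.isAcyclic.mem_support_of_ne_mem_support_of_adj_of_isPath hP hQ hc fun hv => ?_)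
    have h1 := dist_le (Q.takeUntil v hv)
    have h2 := Q.length_takeUntil_le_length hv
    omega
  rw [key w hw h, key w' hw' h']

theorem ncard_neighborSet_ne_one_iff {T : SimpleGraph V} {u v : V} (h : T.Adj v u) :
    (T.neighborSet v).ncard ≠ 1 ↔ ∃ w, T.Adj v w ∧ w ≠ u := by
  rw [Ne, Set.ncard_eq_one, not_iff_comm]
  push Not
  constructor
  · intro hw
    refine ⟨u, Set.ext fun w => ⟨fun hvw => hw w hvw, ?_⟩⟩
    rintro rfl
    exact h
  · rintro ⟨c, hc⟩ w hw
    have h1 : u ∈ T.neighborSet v := h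
    have h2 : w ∈ T.neighborSet v := hw
    rw [hc] at h1 h2
    exact h2.trans h1.symm

theorem dist_le_of_ecc_eq_s13 {T : SimpleGraph V} (hT : T.Connected) {v : V} {n : ℕ}
    (h : ecc T v = n) (u : V) : T.dist v u ≤ n := by
  have h1 : T.edist v u ≤ n := h ▸ le_iSup (fun u => T.edist v u) u
  rw [← (hT v u).coe_dist_eq_edist] at h1
  exact_mod_cast h1

theorem exists_dist_of_ecc_eq [Finite V] {T : SimpleGraph V} (hT : T.Connected) {v : V} {n : ℕ}
    (h : ecc T v = n) : ∃ u, T.dist v u = n := by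
  have : Nonempty V := ⟨v⟩
  obtain ⟨u, hu⟩ := exists_eq_ciSup_of_finite (f := fun u => T.edist v u)
  refine ⟨u, ?_⟩
  have h1 : T.edist v u = n := hu.trans h
  rw [← (hT v u).coe_dist_eq_edist] at h1
  exact_mod_cast h1

open Classical in
/-- The roles determined by the distances to the two central vertices. -/
noncomputable def centralRole (T : SimpleGraph V) (a b v : V) : Role :=
  if T.dist a v = 0 then .a
  else if T.dist b v = 0 then .b
  else if T.dist a v = 1 then if (T.neighborSet v).ncard = 1 then .z else .p
  else if T.dist b v = 1 then if (T.neighborSet v).ncard = 1 then .w else .q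
  else if T.dist a v = 2 then .x
  else .y

set_option maxHeartbeats 1000000 in
theorem isRoleMap_centralRole [Finite V] {T : SimpleGraph V} (hT : T.IsTree) {a b : V}
    (hab : T.Adj a b) (ha : ecc T a = 3) (hb : ecc T b = 3) :
    IsRoleMap T a b (centralRole T a b) := by
  have hC := hT.connected
  have hla : ∀ v, T.dist a v ≤ 3 := dist_le_of_ecc_eq_s13 hC (n := 3) ha
  have hlb : ∀ v, T.dist b v ≤ 3 := dist_le_of_ecc_eq_s13 hC (n := 3) hb
  have hside : ∀ v, T.dist a v = T.dist b v + 1 ∨ T.dist b v = T.dist a v + 1 := by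
    intro v
    rw [T.dist_comm (u := a), T.dist_comm (u := b)]
    exact hT.dist_eq_dist_add_one_of_adj v hab
  have h0a : ∀ v, T.dist a v = 0 ↔ v = a := fun v => by rw [hC.dist_eq_zero_iff, eq_comm]
  have h0b : ∀ v, T.dist b v = 0 ↔ v = b := fun v => by rw [hC.dist_eq_zero_iff, eq_comm]
  have h1a : ∀ v, T.dist a v = 1 ↔ T.Adj a v := fun v => dist_eq_one_iff_adj
  have h1b : ∀ v, T.dist b v = 1 ↔ T.Adj b v := fun v => dist_eq_one_iff_adj
  have hda : ∀ {v w}, T.Adj v w → T.dist a v = T.dist a w + 1 ∨ T.dist a w = T.dist a v + 1 :=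
    fun h => hT.dist_eq_dist_add_one_of_adj a h
  have hdb : ∀ {v w}, T.Adj v w → T.dist b v = T.dist b w + 1 ∨ T.dist b w = T.dist b v + 1 :=
    fun h => hT.dist_eq_dist_add_one_of_adj b h
  have hpred : ∀ r v, T.dist r v ≠ 0 → ∃ w, T.Adj w v ∧ T.dist r v = T.dist r w + 1 := by
    intro r v hv
    obtain ⟨P, -, hP⟩ := hC.exists_path_of_dist r v
    have hpos : 0 < P.length := by omega
    have hnil : ¬ P.Nil := Walk.not_nil_iff_lt_length.2 hpos
    refine ⟨P.penultimate, P.adj_penultimate hnil, ?_⟩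
    have h1 := dist_le P.dropLast
    have h2 : P.dropLast.length = P.length - 1 := by simp
    have h3 := hT.dist_eq_dist_add_one_of_adj r (P.adj_penultimate hnil)
    omega
  have hcross : ∀ {v w}, T.Adj v w → T.dist a v < T.dist b v → T.dist b w < T.dist a w →
      v = a ∧ w = b := by
    intro v w hvw hv hw
    have h1 := hda hvw
    have h2 := hdb hvw
    have h3 := hside v
    have h4 := hside w
    rw [← h0a, ← h0b]
    by_contra hne
    obtain ⟨w', hw', hlt⟩ := hpred b w (by omega)
    have h5 := hda hw'
    have h6 := hside w'
    have : v = w' := eq_of_adj_of_dist_lt hT (r := a) hvw.symm hw'.symm (by omega) (by omega)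
    subst this
    omega
  have hchar : ∀ v,
      (centralRole T a b v = .a ↔ T.dist a v = 0 ∧ T.dist b v = 1) ∧
      (centralRole T a b v = .b ↔ T.dist a v = 1 ∧ T.dist b v = 0) ∧
      (centralRole T a b v = .p ↔
        T.dist a v = 1 ∧ T.dist b v = 2 ∧ (T.neighborSet v).ncard ≠ 1) ∧
      (centralRole T a b v = .q ↔
        T.dist a v = 2 ∧ T.dist b v = 1 ∧ (T.neighborSet v).ncard ≠ 1) ∧
      (centralRole T a b v = .x ↔ T.dist a v = 2 ∧ T.dist b v = 3) ∧
      (centralRole T a b v = .y ↔ T.dist a v = 3 ∧ T.dist b v = 2) ∧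
      (centralRole T a b v = .z ↔
        T.dist a v = 1 ∧ T.dist b v = 2 ∧ (T.neighborSet v).ncard = 1) ∧
      (centralRole T a b v = .w ↔
        T.dist a v = 2 ∧ T.dist b v = 1 ∧ (T.neighborSet v).ncard = 1) := by
    intro v
    have h1 := hside v
    have h2 := hla v
    have h3 := hlb v
    unfold centralRole
    refine ⟨?_, ?_, ?_, ?_, ?_, ?_, ?_, ?_⟩ <;> split_ifs <;>
      simp only [true_iff, false_iff] <;> omega
  simp only [forall_and] at hchar
  obtain ⟨ra, rb, rp, rq, rx, ry, rz, rw₀⟩ := hchar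
  have hdega : ∀ {v w}, T.dist a v = 1 → T.Adj v w → w ≠ a → (T.neighborSet v).ncard ≠ 1 :=
    fun hv hw hne => (ncard_neighborSet_ne_one_iff ((h1a _).1 hv).symm).2 ⟨_, hw, hne⟩
  have hdegb : ∀ {v w}, T.dist b v = 1 → T.Adj v w → w ≠ b → (T.neighborSet v).ncard ≠ 1 :=
    fun hv hw hne => (ncard_neighborSet_ne_one_iff ((h1b _).1 hv).symm).2 ⟨_, hw, hne⟩
  have hcases : ∀ v, (T.dist a v = 0 ∧ T.dist b v = 1) ∨ (T.dist a v = 1 ∧ T.dist b v = 0) ∨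
      (T.dist a v = 1 ∧ T.dist b v = 2) ∨ (T.dist a v = 2 ∧ T.dist b v = 1) ∨
      (T.dist a v = 2 ∧ T.dist b v = 3) ∨ (T.dist a v = 3 ∧ T.dist b v = 2) := by
    intro v
    have h1 := hside v
    have h2 := hla v
    have h3 := hlb v
    omega
  have hadj : ∀ {v w}, T.Adj v w → T.dist a v < T.dist a w →
      (centralRole T a b v).adj (centralRole T a b w) := by
    intro v w hvw hlt
    have h1 := hcases v
    have h2 := hcases w
    have h3 := hda hvw
    have h4 := hdb hvw
    have h5 := h0a v
    have h6 := h0a w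
    have h7 := h0b v
    have h8 := h0b w
    have hc := hcross hvw
    have hd1 := @hdega v w
    have hd2 := @hdegb w v
    generalize hr : centralRole T a b v = r
    generalize ht : centralRole T a b w = t
    rcases r <;> rcases t <;> first | rfl | skip
    all_goals
      simp only [ra, rb, rp, rq, rx, ry, rz, rw₀] at hr ht
      grind
  have hadj' : ∀ {v w}, T.Adj v w → (centralRole T a b v).adj (centralRole T a b w) := by
    intro v w hvw
    rcases hda hvw with h | h
    · rw [Role.adj_comm]
      exact hadj hvw.symm (by omega)
    · exact hadj hvw (by omega)
  have hleafx : ∀ {v}, centralRole T a b v = .x →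
      ∃ w, centralRole T a b w = .p ∧ T.Adj w v ∧ T.Adj a w := by
    intro v hv
    have hv' := (rx v).1 hv
    obtain ⟨w, hw, hd⟩ := hpred a v (by omega)
    have h1 := hdb hw
    have h2 := hcases w
    have hwa : T.dist a w = 1 := by omega
    refine ⟨w, (rp w).2 ⟨hwa, by omega, hdega hwa hw ?_⟩, hw, (h1a w).1 hwa⟩
    rintro rfl
    have := (h0a v).2 rfl
    omega
  have hleafy : ∀ {v}, centralRole T a b v = .y →
      ∃ w, centralRole T a b w = .q ∧ T.Adj w v ∧ T.Adj b w := by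
    intro v hv
    have hv' := (ry v).1 hv
    obtain ⟨w, hw, hd⟩ := hpred b v (by omega)
    have h1 := hda hw
    have h2 := hcases w
    have hwb : T.dist b w = 1 := by omega
    refine ⟨w, (rq w).2 ⟨by omega, hwb, hdegb hwb hw ?_⟩, hw, (h1b w).1 hwb⟩
    rintro rfl
    have := (h0b v).2 rfl
    omega
  have hchildp : ∀ {v}, centralRole T a b v = .p → ∃ w, centralRole T a b w = .x ∧ T.Adj w v := by
    intro v hv
    obtain ⟨h1, h2, h3⟩ := (rp v).1 hv
    obtain ⟨w, hw, hne⟩ := (ncard_neighborSet_ne_one_iff ((h1a v).1 h1).symm).1 h3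
    have h4 := hda hw
    have h5 := hdb hw
    have h6 := mt (h0a w).1 hne
    have h7 := hcases w
    refine ⟨w, (rx w).2 ?_, hw.symm⟩
    by_contra h8
    obtain ⟨rfl, -⟩ := hcross hw (by omega) (by omega)
    have := (h0a v).2 rfl
    omega
  have hchildq : ∀ {v}, centralRole T a b v = .q → ∃ w, centralRole T a b w = .y ∧ T.Adj w v := by
    intro v hv
    obtain ⟨h1, h2, h3⟩ := (rq v).1 hv
    obtain ⟨w, hw, hne⟩ := (ncard_neighborSet_ne_one_iff ((h1b v).1 h2).symm).1 h3
    have h4 := hda hw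
    have h5 := hdb hw
    have h6 := mt (h0b w).1 hne
    have h7 := hcases w
    refine ⟨w, (ry w).2 ?_, hw.symm⟩
    by_contra h8
    obtain ⟨-, rfl⟩ := hcross hw.symm (by omega) (by omega)
    have := (h0b v).2 rfl
    omega
  have hra : ∀ {v}, centralRole T a b v = .a ↔ v = a := by
    intro v
    rw [ra, ← h0a]
    have := hcases v
    omega
  have hrb : ∀ {v}, centralRole T a b v = .b ↔ v = b := by
    intro v
    rw [rb, ← h0b]
    have := hcases v
    omega
  refine ⟨hadj', ?_, ?_, ?_, hra, hrb, ?_, ?_⟩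
  · intro v r hr hrv
    cases hv : centralRole T a b v <;> rw [hv] at hrv <;> revert hrv hr <;> cases r <;>
      first
        | (intro h; exact absurd h (by decide))
        | (intro _ h; exact absurd h (by decide))
        | intro _ _
    · exact ⟨b, hrb.2 rfl, hra.1 hv ▸ hab.symm⟩
    · obtain ⟨u, hu⟩ := exists_dist_of_ecc_eq hC (n := 3) hb
      have := hcases u
      obtain ⟨w, hw, -, haw⟩ := hleafx ((rx u).2 (by omega))
      exact ⟨w, hw, hra.1 hv ▸ haw.symm⟩
    · exact ⟨a, hra.2 rfl, hrb.1 hv ▸ hab⟩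
    · obtain ⟨u, hu⟩ := exists_dist_of_ecc_eq hC (n := 3) ha
      have := hcases u
      obtain ⟨w, hw, -, hbw⟩ := hleafy ((ry u).2 (by omega))
      exact ⟨w, hw, hrb.1 hv ▸ hbw.symm⟩
    · exact ⟨a, hra.2 rfl, (h1a v).1 ((rp v).1 hv).1⟩
    · exact hchildp hv
    · exact ⟨b, hrb.2 rfl, (h1b v).1 ((rq v).1 hv).2.1⟩
    · exact hchildq hv
    · obtain ⟨w, hw, hwv, -⟩ := hleafx hv
      exact ⟨w, hw, hwv⟩
    · obtain ⟨w, hw, hwv, -⟩ := hleafy hv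
      exact ⟨w, hw, hwv⟩
    · exact ⟨a, hra.2 rfl, (h1a v).1 ((rz v).1 hv).1⟩
    · exact ⟨b, hrb.2 rfl, (h1b v).1 ((rw₀ v).1 hv).2.1⟩
  · intro v w hv hvw
    have h1 := hab.symm
    cases hv' : centralRole T a b v <;> rw [hv'] at hv hvw <;> try exact absurd hv (by decide)
    · obtain rfl := hra.1 hv'
      cases hw : centralRole T v b w <;> rw [hw] at hvw <;> try exact absurd hvw (by decide)
      all_goals grind
    · obtain rfl := hrb.1 hv'
      cases hw : centralRole T a v w <;> rw [hw] at hvw <;> try exact absurd hvw (by decide)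
      all_goals grind
  · rintro v w w' (hv | hv) hw hw'
    · have hp : ∀ {u}, T.Adj v u → T.dist a u < T.dist a v := by
        intro u hu
        have h1 := hadj' hu
        have h2 := (rx v).1 hv
        have h3 : ∀ {t}, Role.adj .x t → t = .p := by decide
        rw [hv] at h1
        have h4 := (rp u).1 (h3 h1)
        omega
      exact eq_of_adj_of_dist_lt hT hw hw' (hp hw) (hp hw')
    · have hq : ∀ {u}, T.Adj v u → T.dist b u < T.dist b v := by
        intro u hu
        have h1 := hadj' hu
        have h2 := (ry v).1 hv
        have h3 : ∀ {t}, Role.adj .y t → t = .q := by decide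
        rw [hv] at h1
        have h4 := (rq u).1 (h3 h1)
        omega
      exact eq_of_adj_of_dist_lt hT hw hw' (hq hw) (hq hw')
  · intro v
    rw [rp, ← h1a, show v ≠ b ↔ T.dist b v ≠ 0 from not_congr (h0b v).symm]
    have := hcases v
    omega
  · intro v
    rw [rq, ← h1b, show v ≠ a ↔ T.dist a v ≠ 0 from not_congr (h0a v).symm]
    have := hcases v
    omega

theorem ddist_le_of_dpath {W : Type*} {D : W → W → Prop} {m N : ℕ} {u v : W} (h : DPath D m u v)
    (hm : m ≤ N) : ddist D u v ≤ N :=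
  le_trans (sInf_le ⟨m, rfl, h⟩) (Nat.cast_le.2 hm)

theorem orientNum_le {W : Type*} {G : SimpleGraph W} {D : W → W → Prop} (hD : IsOrientation G D)
    {N : ℕ} (h : ∀ u v, ∃ m ≤ N, DPath D m u v) : orientNum G ≤ N := by
  refine le_trans (sInf_le ⟨D, ⟨hD, fun u v => ?_⟩, rfl⟩) (iSup₂_le fun u v => ?_)
  · obtain ⟨m, -, hm⟩ := h u v
    exact ⟨m, hm⟩
  · obtain ⟨m, hmN, hm⟩ := h u v
    exact ddist_le_of_dpath hm hmN

theorem le_orientNum {W : Type*} {G : SimpleGraph W} {N : ℕ}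
    (h : ∀ D, IsOrientation G D → ∃ u v, ∀ m, DPath D m u v → N ≤ m) : N ≤ orientNum G := by
  refine le_sInf ?_
  rintro _ ⟨D, hD, rfl⟩
  obtain ⟨u, v, huv⟩ := h D hD.1
  refine le_trans (le_sInf ?_) (le_iSup₂ (f := fun u v => ddist D u v) u v)
  rintro _ ⟨m, rfl, hm⟩
  exact_mod_cast huv m hm

theorem exists_orientation_of_orientNum_eq {W : Type*} {G : SimpleGraph W} {N : ℕ}
    (h : orientNum G = N) :
    ∃ D, IsOrientation G D ∧ ∀ u v, ∃ m ≤ N, DPath D m u v := by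
  have hne : {d : ℕ∞ | ∃ D : W → W → Prop, IsStrongOrientation G D ∧ d = odiam D}.Nonempty := by
    by_contra hempty
    rw [Set.not_nonempty_iff_eq_empty] at hempty
    rw [orientNum, hempty, sInf_empty] at h
    exact ENat.natCast_ne_top N h.symm
  obtain ⟨D, hD, hd⟩ := csInf_mem hne
  refine ⟨D, hD.1, fun u v => ?_⟩
  obtain ⟨m₀, hm₀⟩ := hD.2 u v
  obtain ⟨m, hm, hp⟩ := csInf_mem (s := {n : ℕ∞ | ∃ m : ℕ, n = (m : ℕ∞) ∧ DPath D m u v})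
    ⟨m₀, m₀, rfl, hm₀⟩
  refine ⟨m, ?_, hp⟩
  have h1 : ddist D u v ≤ odiam D := le_iSup₂ (f := fun u v => ddist D u v) u v
  rw [← hd] at h1
  have h2 := h1.trans_eq h
  rw [ddist, hm] at h2
  exact_mod_cast h2

/-- A recipe orienting vertex-multiplications: the copies of a vertex of role `r` are sorted into
`cap r` classes, and the direction of an edge depends on the classes of its ends only. -/
structure Scheme where
  cap : Role → ℕ
  /-- Whether edges between two classes lead away from the centre, for roles related by
  `Role.down`. -/
  dir : Role → ℕ → Role → ℕ → Bool

namespace Scheme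

def arc (S : Scheme) (c d : Role × ℕ) : Bool :=
  if c.1.down d.1 then S.dir c.1 c.2 d.1 d.2 else d.1.down c.1 && !S.dir d.1 d.2 c.1 c.2

def classes (S : Scheme) (l : List Role) : List (Role × ℕ) :=
  l.flatMap fun r => (List.range (S.cap r)).map fun k => (r, k)

/-- Search for a directed walk of length `n + 1` between classes. Unless `f` holds it has to use
an edge with `full` ends, one where the two vertex sets are completely joined. -/
def walk (S : Scheme) (full : Role → Role → Bool) : ℕ → Bool → Role × ℕ → Role × ℕ → Bool
  | 0, f, c, d => S.arc c d && (f || full c.1 d.1)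
  | n + 1, f, c, d => (S.classes [.a, .b, .p, .q, .x, .y]).any fun e =>
      S.arc c e && S.walk full n (f || full c.1 e.1) e d

def check (S : Scheme) (full : Role → Role → Bool) (N : ℕ) : Bool :=
  (S.classes [.a, .b, .p, .q, .x, .y, .z, .w]).all fun c =>
    (S.classes [.a, .b, .p, .q, .x, .y, .z, .w]).all fun d =>
      (List.range N).any fun n => S.walk full n false c d

variable (S : Scheme) {T : SimpleGraph V} {a b : V} {role : V → Role} {s : V → ℕ}

def cls (role : V → Role) (u : Σ v, Fin (s v)) : Role × ℕ :=
  (role u.1, min u.2 (S.cap (role u.1) - 1))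

def orient (T : SimpleGraph V) (role : V → Role) (s : V → ℕ) (u v : Σ v, Fin (s v)) : Prop :=
  T.Adj u.1 v.1 ∧ S.arc (S.cls role u) (S.cls role v)

variable {S}

theorem mem_classes {l : List Role} {c : Role × ℕ} :
    c ∈ S.classes l ↔ c.1 ∈ l ∧ c.2 < S.cap c.1 := by
  obtain ⟨r, k⟩ := c
  simp [classes]

theorem adj_of_arc {c d : Role × ℕ} (h : S.arc c d) : c.1.adj d.1 := by
  unfold arc at h
  unfold Role.adj
  split_ifs at h <;> simp_all

theorem arc_eq_not_arc {c d : Role × ℕ} (h : c.1.adj d.1) : S.arc c d = !S.arc d c := by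
  have h1 := @Role.down_asymm c.1 d.1
  have h2 := @Role.down_asymm d.1 c.1
  unfold Role.adj at h
  unfold arc
  cases h3 : c.1.down d.1 <;> cases h4 : d.1.down c.1 <;> simp_all

theorem isOrientation_orient (hrole : IsRoleMap T a b role) :
    IsOrientation (vertexMult T s) (S.orient T role s) := by
  refine ⟨fun u v h => h.1, fun u v h => ?_⟩
  have h1 : T.Adj u.1 v.1 := h
  have h2 := S.arc_eq_not_arc (c := S.cls role u) (d := S.cls role v) (hrole.adj h1)
  simp [orient, h1, h1.symm, h2]

theorem exists_cls_eq (hrole : IsRoleMap T a b role) (hcap : ∀ v, S.cap (role v) ≤ s v)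
    {c : Role × ℕ} (hc : c.1.inner) (hk : c.2 < S.cap c.1) {v : V} (hcv : c.1.adj (role v)) :
    ∃ u : Σ v, Fin (s v), S.cls role u = c ∧ T.Adj u.1 v := by
  obtain ⟨r, k⟩ := c
  obtain ⟨w, rfl, hwv⟩ := hrole.exists_adj v hc hcv
  refine ⟨⟨w, k, hk.trans_le (hcap w)⟩, ?_, hwv⟩
  have : k ≤ S.cap (role w) - 1 := by simp only at hk; omega
  simp [cls, this]

theorem dpath_of_walk (hrole : IsRoleMap T a b role) (hcap : ∀ v, S.cap (role v) ≤ s v)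
    {full : Role → Role → Bool}
    (hfull : ∀ v w, full (role v) (role w) → (role v).adj (role w) → T.Adj v w)
    {n : ℕ} {f : Bool} {c d : Role × ℕ} (h : S.walk full n f c d) {v : Σ v, Fin (s v)}
    (hv : S.cls role v = d) :
    (f = false → ∀ u, S.cls role u = c → DPath (S.orient T role s) (n + 1) u v) ∧
    (f = true → c.1.inner → c.2 < S.cap c.1 →
      ∃ u, S.cls role u = c ∧ DPath (S.orient T role s) (n + 1) u v) := by
  induction n generalizing f c with
  | zero =>
    subst hv
    simp only [walk, Bool.and_eq_true, Bool.or_eq_true] at h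
    constructor
    · rintro rfl u rfl
      exact ⟨v, ⟨hfull _ _ (by simpa [cls] using h.2) (adj_of_arc h.1), h.1⟩, rfl⟩
    · rintro - hc hk
      obtain ⟨u, rfl, hu⟩ := exists_cls_eq hrole hcap hc hk (v := v.1) (adj_of_arc h.1)
      exact ⟨u, rfl, v, ⟨hu, h.1⟩, rfl⟩
  | succ n ih =>
    simp only [walk, List.any_eq_true, Bool.and_eq_true, mem_classes] at h
    obtain ⟨e, ⟨he, hek⟩, hce, hw⟩ := h
    have hei : e.1.inner := by
      revert he
      generalize e.1 = r
      revert r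
      decide
    have ih := ih hw
    constructor
    · rintro rfl u rfl
      cases hf : full (role u.1) e.1
      · obtain ⟨u', rfl, hu'⟩ := exists_cls_eq hrole hcap hei hek (v := u.1)
          ((Role.adj_comm _ _).trans (adj_of_arc hce))
        exact ⟨u', ⟨hu'.symm, hce⟩, ih.1 (by simpa [cls] using hf) u' rfl⟩
      · obtain ⟨u', rfl, hu'⟩ := ih.2 (by simpa [cls] using hf) hei hek
        exact ⟨u', ⟨hfull _ _ hf (adj_of_arc hce), hce⟩, hu'⟩
    · rintro rfl hc hk
      obtain ⟨u', rfl, hu'⟩ := ih.2 rfl hei hek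
      obtain ⟨u, rfl, hu⟩ := exists_cls_eq hrole hcap hc hk (v := u'.1) (adj_of_arc hce)
      exact ⟨u, rfl, u', ⟨hu, hce⟩, hu'⟩

theorem orientNum_le_of_check (hrole : IsRoleMap T a b role) (hpos : ∀ r, 0 < S.cap r)
    (hcap : ∀ v, S.cap (role v) ≤ s v) {full : Role → Role → Bool}
    (hfull : ∀ v w, full (role v) (role w) → (role v).adj (role w) → T.Adj v w)
    {N : ℕ} (h : S.check full N) : orientNum (vertexMult T s) ≤ N := by
  refine orientNum_le (isOrientation_orient (S := S) hrole) fun u v => ?_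
  have hmem : ∀ u : Σ v, Fin (s v),
      S.cls role u ∈ S.classes [.a, .b, .p, .q, .x, .y, .z, .w] := by
    intro u
    refine mem_classes.2 ⟨?_, ?_⟩
    · cases (S.cls role u).1 <;> decide
    · have := hpos (role u.1)
      simp only [cls]
      omega
  simp only [check, List.all_eq_true, List.any_eq_true, List.mem_range] at h
  obtain ⟨n, hn, hw⟩ := h _ (hmem u) _ (hmem v)
  exact ⟨n + 1, hn, (dpath_of_walk hrole hcap hfull hw rfl).1 rfl u rfl⟩

def hubFull (r t : Role) : Bool := r.hub || t.hub

def hubOrPFull (r t : Role) : Bool := r.hub || t.hub || r = .p || t = .p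

/-- A scheme for all multiplicities at least `2`, of diameter `6`. -/
def general : Scheme where
  cap | .a | .b | .p | .q => 2 | _ => 1
  dir
    | .a, k, .b, l => k = 1 && l = 0
    | _, k, _, _ => k = 0

/-- A scheme of diameter `5` when there is only one vertex of role `p`. -/
def ofSingle : Scheme where
  cap | .a | .b | .p | .q | .x => 2 | _ => 1
  dir
    | .a, k, .b, _ => k = 1
    | .b, k, .q, l | .p, k, .x, l => k = l
    | _, k, _, _ => k = 0

/-- A scheme of diameter `5` when the centre `a` has at least three copies. -/
def ofThree : Scheme where
  cap | .a => 3 | .b | .p | .q => 2 | _ => 1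
  dir
    | .a, k, .b, l => k = 1 || (k = 2 && l = 1)
    | .a, k, .p, l => k = 0 || (k = 2 && l = 1)
    | .a, k, .z, _ => k ≠ 1
    | .p, k, .x, _ => k = 1
    | .b, k, .q, l => k = l
    | _, k, _, _ => k = 0

/-- A scheme of diameter `5` when the vertices of roles `p` and `q` have at least four copies. -/
def ofFour : Scheme where
  cap | .a | .b => 2 | .p | .q => 4 | _ => 1
  dir
    | .a, k, .b, l => k = l
    | .a, k, .p, l | .b, k, .q, l => k = l % 2
    | .p, k, .x, _ | .q, k, .y, _ => k < 2
    | _, k, _, _ => k = 0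

theorem check_general : general.check hubFull 6 := by decide +kernel

theorem check_ofSingle : ofSingle.check hubOrPFull 5 := by decide +kernel

theorem check_ofThree : ofThree.check hubFull 5 := by decide +kernel

theorem check_ofFour : ofFour.check hubFull 5 := by decide +kernel

end Scheme

namespace IsRoleMap

variable {T : SimpleGraph V} {a b : V} {role : V → Role} {s : V → ℕ}

theorem adj_of_hubFull (hrole : IsRoleMap T a b role) (v w : V)
    (h : Scheme.hubFull (role v) (role w)) (hadj : (role v).adj (role w)) : T.Adj v w := by
  rcases (Bool.or_eq_true _ _).mp h with h | h
  · exact hrole.adj_of_hub h hadj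
  · exact (hrole.adj_of_hub h ((Role.adj_comm _ _).trans hadj)).symm

theorem adj_of_hubOrPFull (hrole : IsRoleMap T a b role) (hp : {v | role v = .p}.Subsingleton)
    (v w : V) (h : Scheme.hubOrPFull (role v) (role w)) (hadj : (role v).adj (role w)) :
    T.Adj v w := by
  have key : ∀ {v w}, role v = .p → (role v).adj (role w) → T.Adj v w := by
    intro v w hv hadj
    obtain ⟨v', hv', h'⟩ := hrole.exists_adj w (r := role v) (by rw [hv]; rfl) hadj
    obtain rfl : v' = v := hp (hv'.trans hv) hv
    exact h'
  simp only [Scheme.hubOrPFull, Bool.or_eq_true, decide_eq_true_eq] at h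
  rcases h with (h | h) | h
  · exact hrole.adj_of_hubFull v w ((Bool.or_eq_true _ _).mpr h) hadj
  · exact key h hadj
  · exact (key h ((Role.adj_comm _ _).trans hadj)).symm

theorem orientNum_le_six (hrole : IsRoleMap T a b role) (hs : ∀ v, 2 ≤ s v) :
    orientNum (vertexMult T s) ≤ 6 :=
  Scheme.orientNum_le_of_check hrole (by decide)
    (fun v => le_trans (by generalize role v = r; revert r; decide) (hs v))
    hrole.adj_of_hubFull Scheme.check_general

theorem orientNum_le_five_of_single (hrole : IsRoleMap T a b role) (hs : ∀ v, 2 ≤ s v)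
    (hp : {v | role v = .p}.Subsingleton) : orientNum (vertexMult T s) ≤ 5 :=
  Scheme.orientNum_le_of_check hrole (by decide)
    (fun v => le_trans (by generalize role v = r; revert r; decide) (hs v))
    (hrole.adj_of_hubOrPFull hp) Scheme.check_ofSingle

theorem orientNum_le_five_of_three_le (hrole : IsRoleMap T a b role) (hs : ∀ v, 2 ≤ s v)
    (ha : 3 ≤ s a) : orientNum (vertexMult T s) ≤ 5 := by
  refine Scheme.orientNum_le_of_check hrole (by decide) (fun v => ?_)
    hrole.adj_of_hubFull Scheme.check_ofThree
  by_cases hv : role v = .a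
  · rw [hv, hrole.eq_a.1 hv]
    exact ha
  · refine le_trans ?_ (hs v)
    revert hv
    generalize role v = r
    revert r
    decide

theorem orientNum_le_five_of_four_le (hrole : IsRoleMap T a b role) (hs : ∀ v, 2 ≤ s v)
    (hp : ∀ v, role v = .p → 4 ≤ s v) (hq : ∀ v, role v = .q → 4 ≤ s v) :
    orientNum (vertexMult T s) ≤ 5 := by
  refine Scheme.orientNum_le_of_check hrole (by decide) (fun v => ?_)
    hrole.adj_of_hubFull Scheme.check_ofFour
  by_cases hv : role v = .p ∨ role v = .q
  · rcases hv with hv | hv <;> rw [hv]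
    exacts [hp v hv, hq v hv]
  · refine le_trans ?_ (hs v)
    revert hv
    generalize role v = r
    revert r
    decide

theorem pos_of_dpath (hrole : IsRoleMap T a b role)
    {D : (Σ v, Fin (s v)) → (Σ v, Fin (s v)) → Prop}
    (hD : IsOrientation (vertexMult T s) D) {m : ℕ} {u v : Σ v, Fin (s v)} (h : DPath D m u v) :
    (role v.1).pos ≤ (role u.1).pos + m ∧ (role u.1).pos ≤ (role v.1).pos + m ∧
      ((role u.1).pos + (role v.1).pos + m) % 2 = 0 := by
  induction m generalizing u with
  | zero =>
    obtain rfl : u = v := h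
    omega
  | succ m ih =>
    obtain ⟨w, hw, h⟩ := h
    have h1 := ih h
    have h2 := Role.pos_of_adj (hrole.adj (hD.1 _ _ hw))
    omega

theorem five_le_orientNum (hrole : IsRoleMap T a b role) (hs : ∀ v, 0 < s v) :
    5 ≤ orientNum (vertexMult T s) := by
  obtain ⟨v, hv, -⟩ := hrole.exists_adj a (r := .p) rfl (by rw [hrole.eq_a.2 rfl]; rfl)
  obtain ⟨x, hx, -⟩ := hrole.exists_adj v (r := .x) rfl (by rw [hv]; rfl)
  obtain ⟨v', hv', -⟩ := hrole.exists_adj b (r := .q) rfl (by rw [hrole.eq_b.2 rfl]; rfl)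
  obtain ⟨y, hy, -⟩ := hrole.exists_adj v' (r := .y) rfl (by rw [hv']; rfl)
  refine le_orientNum (N := 5) fun D hD => ⟨⟨x, 0, hs x⟩, ⟨y, 0, hs y⟩, fun m hm => ?_⟩
  have := (hrole.pos_of_dpath hD hm).1
  simpa [hx, hy, Role.pos] using this

end IsRoleMap

namespace Role

def swap : Role → Role
  | a => b | b => a | p => q | q => p | x => y | y => x | z => w | w => z

theorem swap_eq_iff : ∀ {r t : Role}, swap r = t ↔ r = swap t := by decide

theorem adj_swap : ∀ r t : Role, adj (swap r) (swap t) = adj r t := by decide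

theorem adj_swap_right : ∀ r t : Role, adj r (swap t) = adj (swap r) t := by decide

theorem hub_swap : ∀ r : Role, hub (swap r) = hub r := by decide

theorem inner_swap : ∀ r : Role, inner (swap r) = inner r := by decide

end Role

theorem IsRoleMap.swap {T : SimpleGraph V} {a b : V} {role : V → Role}
    (h : IsRoleMap T a b role) : IsRoleMap T b a fun v => (role v).swap where
  adj hvw := (Role.adj_swap _ _).trans (h.adj hvw)
  exists_adj v {r} hr hrv := by
    simp only [Role.swap_eq_iff]
    exact h.exists_adj v ((Role.inner_swap r).trans hr) ((Role.adj_swap_right _ _).symm.trans hrv)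
  adj_of_hub hv hvw :=
    h.adj_of_hub ((Role.hub_swap _).symm.trans hv) ((Role.adj_swap _ _).symm.trans hvw)
  leaf hv := h.leaf (by rw [Role.swap_eq_iff, Role.swap_eq_iff] at hv; exact hv.symm)
  eq_a := Role.swap_eq_iff.trans h.eq_b
  eq_b := Role.swap_eq_iff.trans h.eq_a
  eq_p := Role.swap_eq_iff.trans h.eq_q
  eq_q := Role.swap_eq_iff.trans h.eq_p

theorem DPath.flip {W : Type*} {D : W → W → Prop} {m : ℕ} {u v : W} (h : DPath D m u v) :
    DPath (fun u v => D v u) m v u := by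
  have snoc : ∀ {m u v w}, DPath (fun u v => D v u) m u v → D w v →
      DPath (fun u v => D v u) (m + 1) u w := by
    intro m
    induction m with
    | zero => rintro u _ w rfl hw; exact ⟨w, hw, rfl⟩
    | succ m ih => rintro u v w ⟨t, ht, h⟩ hw; exact ⟨t, ht, ih h hw⟩
  induction m generalizing u with
  | zero => exact Eq.symm h
  | succ m ih =>
    obtain ⟨w, hw, h⟩ := h
    exact snoc (ih h) hw

theorem exists_other_copy {s : V → ℕ} {u : Σ v, Fin (s v)} {c : V} (hc : s c = 2) (hu : u.1 = c) :
    ∃ u' : Σ v, Fin (s v), u'.1 = c ∧ ∀ w : Σ v, Fin (s v), w.1 = c → w = u ∨ w = u' := by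
  obtain ⟨v, i⟩ := u
  obtain rfl : v = c := hu
  refine ⟨⟨v, 1 - i, by omega⟩, rfl, ?_⟩
  rintro ⟨v', j⟩ hv'
  obtain rfl : v' = v := hv'
  simp only [Sigma.mk.injEq, heq_eq_eq, true_and, Fin.ext_iff]
  omega

/-- `D` orients `T(s)` with diameter at most `5`, in the case where both centres are doubled and
each of them has at least two non-leaf neighbours besides the other. -/
structure IsTightOrientation (T : SimpleGraph V) (a b : V) (role : V → Role) (s : V → ℕ)
    (D : (Σ v, Fin (s v)) → (Σ v, Fin (s v)) → Prop) : Prop where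
  isRoleMap : IsRoleMap T a b role
  isOrientation : IsOrientation (vertexMult T s) D
  dpath (u v) : ∃ m ≤ 5, DPath D m u v
  pos (v) : 0 < s v
  two_a : s a = 2
  two_b : s b = 2
  exists_p {v} : role v = .p → ∃ v', role v' = .p ∧ v' ≠ v
  exists_q {v} : role v = .q → ∃ v', role v' = .q ∧ v' ≠ v

namespace IsTightOrientation

variable {T : SimpleGraph V} {a b : V} {role : V → Role} {s : V → ℕ}
  {D : (Σ v, Fin (s v)) → (Σ v, Fin (s v)) → Prop} {u v : Σ v, Fin (s v)}

theorem swap (h : IsTightOrientation T a b role s D) :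
    IsTightOrientation T b a (fun v => (role v).swap) s D where
  isRoleMap := h.isRoleMap.swap
  isOrientation := h.isOrientation
  dpath := h.dpath
  pos := h.pos
  two_a := h.two_b
  two_b := h.two_a
  exists_p hv := by
    simp only [Role.swap_eq_iff] at hv ⊢
    exact h.exists_q hv
  exists_q hv := by
    simp only [Role.swap_eq_iff] at hv ⊢
    exact h.exists_p hv

theorem flip (h : IsTightOrientation T a b role s D) :
    IsTightOrientation T a b role s (fun u v => D v u) where
  isRoleMap := h.isRoleMap
  isOrientation := ⟨fun u v huv => (h.isOrientation.1 v u huv).symm,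
    fun u v huv => h.isOrientation.2 v u huv.symm⟩
  dpath u v := by
    obtain ⟨m, hm, hp⟩ := h.dpath v u
    exact ⟨m, hm, hp.flip⟩
  pos := h.pos
  two_a := h.two_a
  two_b := h.two_b
  exists_p := h.exists_p
  exists_q := h.exists_q

theorem asymm (h : IsTightOrientation T a b role s D) (huv : D u v) : ¬ D v u :=
  (h.isOrientation.2 u v (h.isOrientation.1 u v huv)).1 huv

theorem tree_adj (h : IsTightOrientation T a b role s D) (huv : D u v) : T.Adj u.1 v.1 :=
  h.isOrientation.1 u v huv

theorem role_adj (h : IsTightOrientation T a b role s D) (huv : D u v) :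
    (role u.1).adj (role v.1) :=
  h.isRoleMap.adj (h.tree_adj huv)

theorem exists_chain_of_pos (h : IsTightOrientation T a b role s D)
    (hpos : (role v.1).pos = (role u.1).pos + 4 ∨ (role u.1).pos = (role v.1).pos + 4 ∨
      (role u.1).pos = (role v.1).pos ∧ u ≠ v ∧ ∀ w, T.Adj u.1 w → ¬ T.Adj w v.1) :
    ∃ r t w, D u r ∧ D r t ∧ D t w ∧ D w v := by
  obtain ⟨m, hm, hp⟩ := h.dpath u v
  obtain ⟨h1, h2, h3⟩ := h.isRoleMap.pos_of_dpath h.isOrientation hp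
  have h0 : m ≠ 0 := by
    rintro rfl
    obtain rfl : u = v := hp
    simp at hpos
  have h2 : m ≠ 2 := by
    rintro rfl
    obtain ⟨w, huw, _, hwv, rfl⟩ := hp
    rcases hpos with hpos | hpos | hpos
    · omega
    · omega
    · exact hpos.2.2 w.1 (h.tree_adj huw) (h.tree_adj hwv)
  obtain rfl : m = 4 := by omega
  obtain ⟨r, hr, t, ht, w, hw, _, hv, rfl⟩ := hp
  exact ⟨r, t, w, hr, ht, hw, hv⟩

theorem exists_chain_to_q (h : IsTightOrientation T a b role s D) (hu : role u.1 = .x)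
    (hv : role v.1 = .q) :
    ∃ r t w, role r.1 = .p ∧ t.1 = a ∧ w.1 = b ∧ D u r ∧ D r t ∧ D t w ∧ D w v := by
  obtain ⟨r, t, w, hr, ht, hw, hv'⟩ := h.exists_chain_of_pos (u := u) (v := v)
    (by simp [hu, hv, Role.pos])
  obtain ⟨h1, h2, h3⟩ := Role.eq_of_adj_chain_x_q (hu ▸ h.role_adj hr) (h.role_adj ht)
    (h.role_adj hw) (hv ▸ h.role_adj hv')
  exact ⟨r, t, w, h1, h.isRoleMap.eq_a.1 h2, h.isRoleMap.eq_b.1 h3, hr, ht, hw, hv'⟩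

theorem exists_x_adj (h : IsTightOrientation T a b role s D) {v : V} (hv : role v = .p) :
    ∃ u : Σ v, Fin (s v), role u.1 = .x ∧ T.Adj u.1 v := by
  obtain ⟨u, hu, huv⟩ := h.isRoleMap.exists_adj v (r := .x) rfl (by rw [hv]; rfl)
  exact ⟨⟨u, 0, h.pos u⟩, hu, huv⟩

theorem exists_x (h : IsTightOrientation T a b role s D) :
    ∃ u : Σ v, Fin (s v), role u.1 = .x := by
  obtain ⟨v, hv, -⟩ := h.isRoleMap.exists_adj a (r := .p) rfl (by rw [h.isRoleMap.eq_a.2 rfl]; rfl)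
  obtain ⟨u, hu, -⟩ := h.exists_x_adj hv
  exact ⟨u, hu⟩

theorem exists_a_of_p (h : IsTightOrientation T a b role s D) (hu : role u.1 = .p) :
    ∃ t, t.1 = a ∧ D u t := by
  obtain ⟨v, hv⟩ := h.swap.exists_x
  rw [Role.swap_eq_iff] at hv
  obtain ⟨r, t, w, hr, ht, hw, hv'⟩ := h.exists_chain_of_pos (u := u) (v := v)
    (by simp [hu, hv, Role.pos, Role.swap])
  exact ⟨r, h.isRoleMap.eq_a.1 (Role.eq_of_adj_chain_p_y (hu ▸ h.role_adj hr) (h.role_adj ht)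
    (h.role_adj hw) (by simpa [hv, Role.swap] using h.role_adj hv')), hr⟩

theorem exists_chain_of_x (h : IsTightOrientation T a b role s D) (hu : role u.1 = .x) :
    ∃ r t w, t.1 = a ∧ role w.1 = .p ∧ D u r ∧ D r t ∧ D t w := by
  obtain ⟨c, hc, hcu⟩ := h.isRoleMap.exists_adj u.1 (r := .p) rfl (by rw [hu]; rfl)
  obtain ⟨c', hc', hne⟩ := h.exists_p hc
  obtain ⟨v, hv, hvc⟩ := h.exists_x_adj hc'
  have hcommon : ∀ w, T.Adj u.1 w → ¬ T.Adj w v.1 := by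
    intro w huw hwv
    rw [h.isRoleMap.leaf (.inl hu) hcu.symm huw, h.isRoleMap.leaf (.inl hv) hvc hwv.symm] at hne
    exact hne rfl
  obtain ⟨r, t, w, hr, ht, hw, hv'⟩ := h.exists_chain_of_pos (u := u) (v := v) (by
    refine .inr (.inr ⟨by rw [hu, hv], ?_, hcommon⟩)
    rintro rfl
    exact hcommon c hcu.symm hcu)
  obtain ⟨h1, h2 | h2, h3⟩ := Role.eq_of_adj_chain_x_x (hu ▸ h.role_adj hr) (h.role_adj ht)
    (h.role_adj hw) (hv ▸ h.role_adj hv')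
  · exact ⟨r, t, w, h.isRoleMap.eq_a.1 h2, h3, hr, ht, hw⟩
  · have hrw := h.isRoleMap.leaf (.inl h2) (h.tree_adj ht).symm (h.tree_adj hw)
    exact absurd (hrw ▸ h.tree_adj hv') (hcommon _ (h.tree_adj hr))

theorem exists_out (h : IsTightOrientation T a b role s D) (hu : role u.1 = .x)
    {α : Σ v, Fin (s v)} (hα : α.1 = a) : ∃ r, D u r ∧ D r α := by
  by_contra! hno
  obtain ⟨β, hβ, hαβ⟩ := exists_other_copy h.two_a hα
  have eq_β : ∀ {r t}, D u r → D r t → t.1 = a → t = β := by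
    intro r t hr ht hta
    rcases hαβ t hta with rfl | rfl
    · exact absurd ht (hno r hr)
    · rfl
  obtain ⟨y, hy⟩ := h.swap.exists_x
  have hβb : ∀ {t}, t.1 = b → D β t := by
    intro t ht
    by_contra hβt
    obtain ⟨t', ht', htt'⟩ := exists_other_copy h.two_b ht
    have hq : ∀ {v : Σ v, Fin (s v)}, role v.1 = .q → D t' v := by
      intro v hv
      obtain ⟨r, α', w, -, hα', hw, hur, hrα, hαw, hwv⟩ := h.exists_chain_to_q hu hv
      obtain rfl := eq_β hur hrα hα'
      rcases htt' w hw with rfl | rfl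
      · exact absurd hαw hβt
      · exact hwv
    obtain ⟨r, w, q, hw, hq', hyr, hrw, hwq⟩ := h.swap.exists_chain_of_x hy
    rw [Role.swap_eq_iff] at hy hq'
    have hr : role r.1 = .q := by
      have h1 := h.role_adj hyr
      have h2 := h.role_adj hrw
      rw [hy] at h1
      rw [h.isRoleMap.eq_b.2 hw] at h2
      revert h1 h2
      generalize role r.1 = ρ
      revert ρ
      decide
    have hwt : w = t := by
      rcases htt' w hw with rfl | rfl
      · rfl
      · exact absurd hrw (h.asymm (hq hr))
    subst hwt
    obtain ⟨w', hw', hqw'⟩ := h.swap.exists_a_of_p (u := q) (by rw [Role.swap_eq_iff, hq'])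
    rcases htt' w' hw' with rfl | rfl
    · exact h.asymm hqw' hwq
    · exact h.asymm hqw' (hq hq')
  have hαp : ∀ {v : Σ v, Fin (s v)}, role v.1 = .p → D α v := by
    intro v hv
    obtain ⟨r, t, α', -, ht, hα', -, -, htα, hαv⟩ :=
      h.swap.exists_chain_to_q (v := v) hy (by rw [Role.swap_eq_iff, hv]; rfl)
    rcases hαβ α' hα' with rfl | rfl
    · exact hαv
    · exact absurd htα (h.asymm (hβb ht))
  obtain ⟨r, t, v, ht, hv, hur, hrt, htv⟩ := h.exists_chain_of_x hu
  obtain rfl := eq_β hur hrt ht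
  obtain ⟨α', hα', hvα⟩ := h.exists_a_of_p hv
  rcases hαβ α' hα' with rfl | rfl
  · exact h.asymm hvα (hαp hv)
  · exact h.asymm hvα htv

theorem four_le (h : IsTightOrientation T a b role s D) {c : V} (hc : role c = .p) :
    4 ≤ s c := by
  obtain ⟨u, hu, huc⟩ := h.exists_x_adj hc
  have hfst : ∀ {r}, T.Adj u.1 r → r = c := fun hr => h.isRoleMap.leaf (.inl hu) hr huc
  have hsnd : ∀ {r r' : Σ v, Fin (s v)}, r.1 = c → r'.1 = c → r ≠ r' → (r.2 : ℕ) ≠ r'.2 := by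
    rintro ⟨_, i⟩ ⟨_, j⟩ rfl h1 hne hij
    obtain rfl := h1
    exact hne (by simpa [Fin.ext_iff] using hij)
  let α : Σ v, Fin (s v) := ⟨a, 0, h.pos a⟩
  obtain ⟨β, hβ, hαβ⟩ := exists_other_copy (u := α) h.two_a rfl
  have hout : ∀ {r}, r.1 = c → D r α → ¬ D r β := by
    intro r hr h1 h2
    obtain ⟨t, ht, htr⟩ := h.flip.exists_a_of_p (u := r) (by rw [hr, hc])
    rcases hαβ t ht with rfl | rfl
    exacts [h.asymm h1 htr, h.asymm h2 htr]
  have hin : ∀ {r}, r.1 = c → D α r → ¬ D β r := by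
    intro r hr h1 h2
    obtain ⟨t, ht, htr⟩ := h.exists_a_of_p (u := r) (by rw [hr, hc])
    rcases hαβ t ht with rfl | rfl
    exacts [h.asymm h1 htr, h.asymm h2 htr]
  obtain ⟨r₁, hu₁, h₁⟩ := h.exists_out hu (α := α) rfl
  obtain ⟨r₂, hu₂, h₂⟩ := h.exists_out hu hβ
  obtain ⟨r₃, hu₃, h₃⟩ := h.flip.exists_out hu (α := α) rfl
  obtain ⟨r₄, hu₄, h₄⟩ := h.flip.exists_out hu hβ
  have e₁ := hfst (h.tree_adj hu₁)
  have e₂ := hfst (h.tree_adj hu₂)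
  have e₃ := hfst (h.tree_adj hu₃).symm
  have e₄ := hfst (h.tree_adj hu₄).symm
  have n₁₂ := hsnd e₁ e₂ (by rintro rfl; exact hout e₁ h₁ h₂)
  have n₁₃ := hsnd e₁ e₃ (by rintro rfl; exact h.asymm hu₁ hu₃)
  have n₁₄ := hsnd e₁ e₄ (by rintro rfl; exact h.asymm hu₁ hu₄)
  have n₂₃ := hsnd e₂ e₃ (by rintro rfl; exact h.asymm hu₂ hu₃)
  have n₂₄ := hsnd e₂ e₄ (by rintro rfl; exact h.asymm hu₂ hu₄)
  have n₃₄ := hsnd e₃ e₄ (by rintro rfl; exact hin e₃ h₃ h₄)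
  have l₁ : (r₁.2 : ℕ) < s c := r₁.2.2.trans_eq (by rw [e₁])
  have l₂ : (r₂.2 : ℕ) < s c := r₂.2.2.trans_eq (by rw [e₂])
  have l₃ : (r₃.2 : ℕ) < s c := r₃.2.2.trans_eq (by rw [e₃])
  have l₄ : (r₄.2 : ℕ) < s c := r₄.2.2.trans_eq (by rw [e₄])
  omega

end IsTightOrientation

theorem exists_mem_ne_of_ncard_ne_one {A : Set V} (h : A.ncard ≠ 1) {v : V} (hv : v ∈ A) :
    ∃ v' ∈ A, v' ≠ v := by
  by_contra! hA
  exact h (Set.ncard_eq_one.2 ⟨v, Set.eq_singleton_iff_unique_mem.2 ⟨hv, hA⟩⟩)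

theorem subsingleton_of_ncard_eq_one {A : Set V} (h : A.ncard = 1) : A.Subsingleton := by
  obtain ⟨v, rfl⟩ := Set.ncard_eq_one.1 h
  exact Set.subsingleton_singleton

theorem stmt13 [Fintype V] (T : SimpleGraph V) (hT : T.IsTree) (hdiam : T.ediam = 5)
    (v₁ v₂ : V) (hadj : T.Adj v₁ v₂) (hecc₁ : ecc T v₁ = 3) (hecc₂ : ecc T v₂ = 3)
    (s : V → ℕ) (hs : ∀ v, 2 ≤ s v)
    (NL₁ NL₂ : Set V)
    (hNL₁ : NL₁ = {u : V | T.Adj v₁ u ∧ u ≠ v₂ ∧ (T.neighborSet u).ncard ≠ 1})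
    (hNL₂ : NL₂ = {u : V | T.Adj v₂ u ∧ u ≠ v₁ ∧ (T.neighborSet u).ncard ≠ 1})
    (m₁ m₂ : ℕ) (hm₁ : m₁ = sInf (s '' NL₁)) (hm₂ : m₂ = sInf (s '' NL₂))
    :
    (orientNum (vertexMult T s) = 5 ↔
      ((3 ≤ s v₁ ∨ 3 ≤ s v₂) ∨ (4 ≤ m₁ ∧ 4 ≤ m₂) ∨ NL₁.ncard = 1 ∨ NL₂.ncard = 1)) ∧
    (¬((3 ≤ s v₁ ∨ 3 ≤ s v₂) ∨ (4 ≤ m₁ ∧ 4 ≤ m₂) ∨ NL₁.ncard = 1 ∨ NL₂.ncard = 1) →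
      orientNum (vertexMult T s) = 6) := by
  have hrole := isRoleMap_centralRole hT hadj hecc₁ hecc₂
  obtain rfl : NL₁ = {v | centralRole T v₁ v₂ v = .p} := hNL₁.trans (Set.ext fun _ => hrole.eq_p.symm)
  obtain rfl : NL₂ = {v | centralRole T v₁ v₂ v = .q} := hNL₂.trans (Set.ext fun _ => hrole.eq_q.symm)
  clear hNL₁ hNL₂
  generalize centralRole T v₁ v₂ = role at *
  obtain ⟨p, hp, -⟩ := hrole.exists_adj v₁ (r := .p) rfl (by rw [hrole.eq_a.2 rfl]; rfl)
  obtain ⟨q, hq, -⟩ := hrole.exists_adj v₂ (r := .q) rfl (by rw [hrole.eq_b.2 rfl]; rfl)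
  have hm : ∀ {A : Set V} {v}, v ∈ A → (4 ≤ sInf (s '' A) ↔ ∀ v ∈ A, 4 ≤ s v) := by
    intro A v hv
    rw [le_csInf_iff (OrderBot.bddBelow _) ⟨_, Set.mem_image_of_mem s hv⟩, Set.forall_mem_image]
  rw [hm₁, hm₂, hm (A := {v | role v = .p}) hp, hm (A := {v | role v = .q}) hq]
  have hpos : ∀ v, 0 < s v := fun v => two_pos.trans_le (hs v)
  have h5 := hrole.five_le_orientNum hpos
  have key : orientNum (vertexMult T s) = 5 ↔
      ((3 ≤ s v₁ ∨ 3 ≤ s v₂) ∨ ((∀ v ∈ {v | role v = .p}, 4 ≤ s v) ∧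
        ∀ v ∈ {v | role v = .q}, 4 ≤ s v) ∨ {v | role v = .p}.ncard = 1 ∨
        {v | role v = .q}.ncard = 1) := by
    constructor
    · intro h
      by_contra! hcon
      obtain ⟨⟨h₁, h₂⟩, h₃, h₄, h₅⟩ := hcon
      obtain ⟨D, hD, hdist⟩ := exists_orientation_of_orientNum_eq (N := 5) h
      have hD : IsTightOrientation T v₁ v₂ role s D :=
        { isRoleMap := hrole
          isOrientation := hD
          dpath := hdist
          pos := hpos
          two_a := le_antisymm (by omega) (hs v₁)
          two_b := le_antisymm (by omega) (hs v₂)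
          exists_p := fun hv => exists_mem_ne_of_ncard_ne_one h₄ hv
          exists_q := fun hv => exists_mem_ne_of_ncard_ne_one h₅ hv }
      obtain ⟨v, hv, hlt⟩ := h₃ fun v hv => hD.four_le hv
      exact hlt.not_ge (hD.swap.four_le (Role.swap_eq_iff.2 hv))
    · intro h
      refine le_antisymm ?_ h5
      have hq' : {v | (role v).swap = .p} = {v | role v = .q} :=
        Set.ext fun _ => Role.swap_eq_iff
      rcases h with (h | h) | h | h | h
      · exact hrole.orientNum_le_five_of_three_le hs h
      · exact hrole.swap.orientNum_le_five_of_three_le hs h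
      · exact hrole.orientNum_le_five_of_four_le hs h.1 h.2
      · exact hrole.orientNum_le_five_of_single hs (subsingleton_of_ncard_eq_one h)
      · exact hrole.swap.orientNum_le_five_of_single hs
          (hq' ▸ subsingleton_of_ncard_eq_one h)
  refine ⟨key, fun h => le_antisymm (hrole.orientNum_le_six hs) ?_⟩
  have h6 : (5 : ℕ∞) < orientNum (vertexMult T s) := lt_of_le_of_ne h5 (Ne.symm (mt key.1 h))
  exact Order.add_one_le_of_lt h6
end
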